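/- Let n10 be the 7-dimensional nilpotent real Lie algebra with basis e1,…,e7 and only nonzero brackets [e1,e2] = −e4, [e1,e3] = −e5, [e2,e3] = −e6 (up to antisymmetry). Then: (i) the space of closed alternating 3-forms on n10 has dimension 27; (ii) the space of derivations of n10 has dimension 25; (iii) the 3-form φ = e^{123}+e^{145}+e^{167}−e^{246}+2e^{257}+e^{347}+e^{356} is closed and the space of derivations stabilizing φ has dimension 1; (iv) there exists δ > 0 such that for every real ε with 0 < |ε| < δ, the only derivation of n10 stabilizing φ_ε := φ + ε(e^{257}+e^{347}) is 0. -/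

import Mathlib

noncomputable section

/-- The underlying 7-dimensional real vector space. -/
abbrev V : Type := Fin 7 → ℝ

/-- The Lie bracket of the nilpotent Lie algebra `n₁₀` ([e1,e2] = -e4, [e1,e3] = -e5, [e2,e3] = -e6), extended bilinearly from the structure constants. -/
def bk (x y : V) : V :=
  ![0, 0, 0, -(x 0 * y 1 - x 1 * y 0), -(x 0 * y 2 - x 2 * y 0), -(x 1 * y 2 - x 2 * y 1), 0]

/-- The alternating 3-form `e^i ∧ e^j ∧ e^k` on `V`. -/
def w3 (i j k : Fin 7) : AlternatingMap ℝ V ℝ (Fin 3) :=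
  (Matrix.detRowAlternating : AlternatingMap ℝ (Fin 3 → ℝ) ℝ (Fin 3)).compLinearMap
    (LinearMap.pi (fun a => LinearMap.proj (![i, j, k] a)))

/-- Chevalley–Eilenberg differential of a 3-form, as a scalar-valued function. -/
def d3 (φ : AlternatingMap ℝ V ℝ (Fin 3)) (x₀ x₁ x₂ x₃ : V) : ℝ :=
  -(φ ![bk x₀ x₁, x₂, x₃]) + φ ![bk x₀ x₂, x₁, x₃] - φ ![bk x₀ x₃, x₁, x₂]
    - φ ![bk x₁ x₂, x₀, x₃] + φ ![bk x₁ x₃, x₀, x₂] - φ ![bk x₂ x₃, x₀, x₁]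

/-- A 3-form is closed if its Chevalley–Eilenberg differential vanishes. -/
def Closed3 (φ : AlternatingMap ℝ V ℝ (Fin 3)) : Prop :=
  ∀ x₀ x₁ x₂ x₃ : V, d3 φ x₀ x₁ x₂ x₃ = 0

/-- A linear map `D : V → V` is a derivation of the Lie algebra `(V, bk)`. -/
def IsDeriv (D : V →ₗ[ℝ] V) : Prop :=
  ∀ x y : V, D (bk x y) = bk (D x) y + bk x (D y)

/-- `D` stabilizes (annihilates infinitesimally) the 3-form `φ`. -/
def Stab3 (φ : AlternatingMap ℝ V ℝ (Fin 3)) (D : V →ₗ[ℝ] V) : Prop :=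
  ∀ x y z : V, φ ![D x, y, z] + φ ![x, D y, z] + φ ![x, y, D z] = 0

/-- The distinguished 3-form. -/
def phi : AlternatingMap ℝ V ℝ (Fin 3) :=
  w3 0 1 2 + w3 0 3 4 + w3 0 5 6 - w3 1 3 5 + (2 : ℝ) • w3 1 4 6 + w3 2 3 6 + w3 2 4 5

/-- The perturbation 3-form. -/
def eta : AlternatingMap ℝ V ℝ (Fin 3) :=
  w3 1 4 6 + w3 2 3 6

/-- The standard basis vector `e_{i+1}` of `V`. -/
abbrev stdVec (i : Fin 7) : V := Pi.single i 1

theorem eq_sum_stdVec (x : V) : x = ∑ i, x i • stdVec i := by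
  ext j
  simp [Finset.sum_apply, Pi.single_apply]

theorem linearMap_apply_eq_sum (D : V →ₗ[ℝ] V) (x : V) (i : Fin 7) :
    D x i = ∑ j, x j * D (stdVec j) i := by
  conv_lhs => rw [eq_sum_stdVec x]
  simp [Finset.sum_apply]

theorem linearMap_ext_stdVec {D D' : V →ₗ[ℝ] V}
    (h : ∀ j i, D (stdVec j) i = D' (stdVec j) i) : D = D' := by
  refine LinearMap.ext fun x => funext fun i => ?_
  rw [linearMap_apply_eq_sum D, linearMap_apply_eq_sum D']
  simp only [h]

/-! ### Derivations -/

/-- Linear functionals on `End V` cutting out the derivations: a derivation has block form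
`[A 0 0; * Λ²A *; * 0 *]` with respect to `⟨e₁, e₂, e₃⟩ ⊕ ⟨e₄, e₅, e₆⟩ ⊕ ⟨e₇⟩`. -/
def derivDefect : (V →ₗ[ℝ] V) →ₗ[ℝ] (Fin 24 → ℝ) where
  toFun D :=
    let m : Fin 7 → Fin 7 → ℝ := fun i j => D (stdVec j) i
    ![m 0 3, m 0 4, m 0 5, m 0 6, m 1 3, m 1 4, m 1 5, m 1 6, m 2 3, m 2 4, m 2 5, m 2 6,
      m 6 3, m 6 4, m 6 5,
      m 3 3 - (m 0 0 + m 1 1), m 4 3 - m 2 1, m 5 3 + m 2 0,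
      m 3 4 - m 1 2, m 4 4 - (m 0 0 + m 2 2), m 5 4 - m 1 0,
      m 3 5 + m 0 2, m 4 5 - m 0 1, m 5 5 - (m 1 1 + m 2 2)]
  map_add' D D' := by
    ext k
    fin_cases k <;> simp <;> ring
  map_smul' c D := by
    ext k
    fin_cases k <;> simp <;> ring

theorem derivDefect_surjective : Function.Surjective derivDefect := fun c => by
  refine ⟨Matrix.toLin' !![0, 0, 0, c 0, c 1, c 2, c 3;
    0, 0, 0, c 4, c 5, c 6, c 7;
    0, 0, 0, c 8, c 9, c 10, c 11;
    0, 0, 0, c 15, c 18, c 21, 0;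
    0, 0, 0, c 16, c 19, c 22, 0;
    0, 0, 0, c 17, c 20, c 23, 0;
    0, 0, 0, c 12, c 13, c 14, 0], ?_⟩
  ext k
  fin_cases k <;> simp [derivDefect]

theorem bk_stdVec_zero_one : bk (stdVec 0) (stdVec 1) = -stdVec 3 := by
  ext i; fin_cases i <;> simp [bk]

theorem bk_stdVec_zero_six : bk (stdVec 0) (stdVec 6) = 0 := by
  ext i; fin_cases i <;> simp [bk]

theorem bk_stdVec_one_six : bk (stdVec 1) (stdVec 6) = 0 := by
  ext i; fin_cases i <;> simp [bk]

theorem bk_stdVec_zero_two : bk (stdVec 0) (stdVec 2) = -stdVec 4 := by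
  ext i; fin_cases i <;> simp [bk]

theorem bk_stdVec_one_two : bk (stdVec 1) (stdVec 2) = -stdVec 5 := by
  ext i; fin_cases i <;> simp [bk]

theorem bk_eq (x y : V) :
    bk x y = (x 1 * y 0 - x 0 * y 1) • stdVec 3 + (x 2 * y 0 - x 0 * y 2) • stdVec 4 +
      (x 2 * y 1 - x 1 * y 2) • stdVec 5 := by
  ext i; fin_cases i <;> simp [bk]

theorem isDeriv_iff (D : V →ₗ[ℝ] V) : IsDeriv D ↔ derivDefect D = 0 := by
  constructor
  · intro h
    have h01 := h (stdVec 0) (stdVec 1)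
    have h02 := h (stdVec 0) (stdVec 2)
    have h12 := h (stdVec 1) (stdVec 2)
    rw [bk_stdVec_zero_one, map_neg] at h01
    rw [bk_stdVec_zero_two, map_neg] at h02
    rw [bk_stdVec_one_two, map_neg] at h12
    have h06 := h (stdVec 0) (stdVec 6)
    have h16 := h (stdVec 1) (stdVec 6)
    rw [bk_stdVec_zero_six, map_zero] at h06
    rw [bk_stdVec_one_six, map_zero] at h16
    have k01 := fun i => congrFun h01 i
    have k02 := fun i => congrFun h02 i
    have k12 := fun i => congrFun h12 i
    have k06 := fun i => congrFun h06 i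
    have k16 := fun i => congrFun h16 i
    simp [Fin.forall_fin_succ, bk] at k01 k02 k12 k06 k16
    ext k
    fin_cases k <;> simp [derivDefect] <;> linarith
  · intro h x y
    have hk := fun k => congrFun h k
    simp [Fin.forall_fin_succ, derivDefect] at hk
    obtain ⟨h03, h04, h05, h06, h13, h14, h15, h16, h23, h24, h25, h26, h63, h64, h65,
      h33, h43, h53, h34, h44, h54, h35, h45, h55⟩ := hk
    have hx := fun z i => linearMap_apply_eq_sum D z i
    simp only [Fin.sum_univ_seven] at hx
    rw [bk_eq]
    ext i
    fin_cases i <;> simp [bk, hx x, hx y, h03, h04, h05, h06, h13, h14, h15, h16, h23, h24, h25, h26, h63, h64, h65]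
    · linear_combination (x 1 * y 0 - x 0 * y 1) * h33 + (x 2 * y 0 - x 0 * y 2) * h34 +
        (x 2 * y 1 - x 1 * y 2) * h35
    · linear_combination (x 1 * y 0 - x 0 * y 1) * h43 + (x 2 * y 0 - x 0 * y 2) * h44 +
        (x 2 * y 1 - x 1 * y 2) * h45
    · linear_combination (x 1 * y 0 - x 0 * y 1) * h53 + (x 2 * y 0 - x 0 * y 2) * h54 +
        (x 2 * y 1 - x 1 * y 2) * h55

/-! ### Closed forms -/


theorem finrank_ker_of_surjective {U W : Type*} [AddCommGroup U] [Module ℝ U] [FiniteDimensional ℝ U]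
    [AddCommGroup W] [Module ℝ W] (f : U →ₗ[ℝ] W) (hf : Function.Surjective f) :
    Module.finrank ℝ W + Module.finrank ℝ (LinearMap.ker f) = Module.finrank ℝ U := by
  rw [← f.finrank_range_add_finrank_ker, LinearMap.range_eq_top.mpr hf, finrank_top]

theorem finrank_ker_derivDefect : Module.finrank ℝ (LinearMap.ker derivDefect) = 25 := by
  have h := finrank_ker_of_surjective _ derivDefect_surjective
  simp [Module.finrank_linearMap] at h
  omega

theorem finrank_alternatingMap (n : ℕ) {U : Type*} [AddCommGroup U] [Module ℝ U] [FiniteDimensional ℝ U] :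
    Module.finrank ℝ (AlternatingMap ℝ U ℝ (Fin n)) = (Module.finrank ℝ U).choose n := by
  rw [(exteriorPower.alternatingMapLinearEquiv (R := ℝ) (M := U) (N := ℝ) (n := n)).finrank_eq,
    Module.finrank_linearMap, exteriorPower.finrank_eq, Module.finrank_self, mul_one]

instance (n : ℕ) {U : Type*} [AddCommGroup U] [Module ℝ U] [FiniteDimensional ℝ U] :
    FiniteDimensional ℝ (AlternatingMap ℝ U ℝ (Fin n)) :=
  Module.Finite.equiv (exteriorPower.alternatingMapLinearEquiv (R := ℝ) (M := U) (N := ℝ) (n := n)).symm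

/-! ### Closed forms -/

theorem map_swap_left (φ : AlternatingMap ℝ V ℝ (Fin 3)) (x y z : V) :
    φ ![y, x, z] = -φ ![x, y, z] := by
  have := φ.map_swap ![x, y, z] (i := 0) (j := 1) (by decide)
  rw [← this]; congr 1; ext i; fin_cases i <;> rfl

theorem map_swap_right (φ : AlternatingMap ℝ V ℝ (Fin 3)) (x y z : V) :
    φ ![x, z, y] = -φ ![x, y, z] := by
  have := φ.map_swap ![x, y, z] (i := 1) (j := 2) (by decide)
  rw [← this]; congr 1; ext i; fin_cases i <;> rfl

theorem map_left_self (φ : AlternatingMap ℝ V ℝ (Fin 3)) (x z : V) : φ ![x, x, z] = 0 :=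
  φ.map_eq_zero_of_eq _ (i := 0) (j := 1) rfl (by decide)

theorem map_right_self (φ : AlternatingMap ℝ V ℝ (Fin 3)) (x z : V) : φ ![x, z, z] = 0 :=
  φ.map_eq_zero_of_eq _ (i := 1) (j := 2) rfl (by decide)

theorem map_outer_self (φ : AlternatingMap ℝ V ℝ (Fin 3)) (x z : V) : φ ![z, x, z] = 0 :=
  φ.map_eq_zero_of_eq _ (i := 0) (j := 2) rfl (by decide)

theorem map_eq_sum_left (φ : AlternatingMap ℝ V ℝ (Fin 3)) (x y z : V) :
    φ ![x, y, z] = ∑ i, x i * φ ![stdVec i, y, z] := by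
  let f : V →ₗ[ℝ] ℝ :=
    ⟨⟨fun v => φ ![v, y, z], fun a b => φ.map_vecCons_add _ a b⟩,
      fun c a => φ.map_vecCons_smul _ c a⟩
  change f x = ∑ i, x i * f (stdVec i)
  conv_lhs => rw [eq_sum_stdVec x]
  simp only [map_sum, map_smul, smul_eq_mul]

theorem map_eq_sum_middle (φ : AlternatingMap ℝ V ℝ (Fin 3)) (x y z : V) :
    φ ![x, y, z] = ∑ i, y i * φ ![x, stdVec i, z] := by
  rw [map_swap_left, map_eq_sum_left, ← Finset.sum_neg_distrib]
  simp only [map_swap_left φ x, mul_neg, neg_neg]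

theorem map_eq_sum_right (φ : AlternatingMap ℝ V ℝ (Fin 3)) (x y z : V) :
    φ ![x, y, z] = ∑ i, z i * φ ![x, y, stdVec i] := by
  rw [map_swap_right, map_eq_sum_middle, ← Finset.sum_neg_distrib]
  simp only [map_swap_right φ x y, mul_neg, neg_neg]

theorem map_eq_sum_pairs (φ : AlternatingMap ℝ V ℝ (Fin 3)) (u y z : V) :
    φ ![u, y, z] =
      (y 0 * z 1 - y 1 * z 0) * φ ![u, stdVec 0, stdVec 1] +
      (y 0 * z 2 - y 2 * z 0) * φ ![u, stdVec 0, stdVec 2] +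
      (y 0 * z 3 - y 3 * z 0) * φ ![u, stdVec 0, stdVec 3] +
      (y 0 * z 4 - y 4 * z 0) * φ ![u, stdVec 0, stdVec 4] +
      (y 0 * z 5 - y 5 * z 0) * φ ![u, stdVec 0, stdVec 5] +
      (y 0 * z 6 - y 6 * z 0) * φ ![u, stdVec 0, stdVec 6] +
      (y 1 * z 2 - y 2 * z 1) * φ ![u, stdVec 1, stdVec 2] +
      (y 1 * z 3 - y 3 * z 1) * φ ![u, stdVec 1, stdVec 3] +
      (y 1 * z 4 - y 4 * z 1) * φ ![u, stdVec 1, stdVec 4] +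
      (y 1 * z 5 - y 5 * z 1) * φ ![u, stdVec 1, stdVec 5] +
      (y 1 * z 6 - y 6 * z 1) * φ ![u, stdVec 1, stdVec 6] +
      (y 2 * z 3 - y 3 * z 2) * φ ![u, stdVec 2, stdVec 3] +
      (y 2 * z 4 - y 4 * z 2) * φ ![u, stdVec 2, stdVec 4] +
      (y 2 * z 5 - y 5 * z 2) * φ ![u, stdVec 2, stdVec 5] +
      (y 2 * z 6 - y 6 * z 2) * φ ![u, stdVec 2, stdVec 6] +
      (y 3 * z 4 - y 4 * z 3) * φ ![u, stdVec 3, stdVec 4] +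
      (y 3 * z 5 - y 5 * z 3) * φ ![u, stdVec 3, stdVec 5] +
      (y 3 * z 6 - y 6 * z 3) * φ ![u, stdVec 3, stdVec 6] +
      (y 4 * z 5 - y 5 * z 4) * φ ![u, stdVec 4, stdVec 5] +
      (y 4 * z 6 - y 6 * z 4) * φ ![u, stdVec 4, stdVec 6] +
      (y 5 * z 6 - y 6 * z 5) * φ ![u, stdVec 5, stdVec 6] := by
  rw [map_eq_sum_middle]
  simp only [map_eq_sum_right φ u (stdVec _) z, Fin.sum_univ_seven, map_right_self]
  rw [map_swap_right φ u (stdVec 0) (stdVec 1),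
    map_swap_right φ u (stdVec 0) (stdVec 2),
    map_swap_right φ u (stdVec 0) (stdVec 3),
    map_swap_right φ u (stdVec 0) (stdVec 4),
    map_swap_right φ u (stdVec 0) (stdVec 5),
    map_swap_right φ u (stdVec 0) (stdVec 6),
    map_swap_right φ u (stdVec 1) (stdVec 2),
    map_swap_right φ u (stdVec 1) (stdVec 3),
    map_swap_right φ u (stdVec 1) (stdVec 4),
    map_swap_right φ u (stdVec 1) (stdVec 5),
    map_swap_right φ u (stdVec 1) (stdVec 6),
    map_swap_right φ u (stdVec 2) (stdVec 3),
    map_swap_right φ u (stdVec 2) (stdVec 4),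
    map_swap_right φ u (stdVec 2) (stdVec 5),
    map_swap_right φ u (stdVec 2) (stdVec 6),
    map_swap_right φ u (stdVec 3) (stdVec 4),
    map_swap_right φ u (stdVec 3) (stdVec 5),
    map_swap_right φ u (stdVec 3) (stdVec 6),
    map_swap_right φ u (stdVec 4) (stdVec 5),
    map_swap_right φ u (stdVec 4) (stdVec 6),
    map_swap_right φ u (stdVec 5) (stdVec 6)]
  ring

theorem map_bk (φ : AlternatingMap ℝ V ℝ (Fin 3)) (x y z w : V) :
    φ ![bk x y, z, w] = (x 1 * y 0 - x 0 * y 1) * φ ![stdVec 3, z, w] +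
      (x 2 * y 0 - x 0 * y 2) * φ ![stdVec 4, z, w] +
      (x 2 * y 1 - x 1 * y 2) * φ ![stdVec 5, z, w] := by
  rw [map_eq_sum_left]
  simp only [Fin.sum_univ_seven]
  simp [bk]

/-- The coordinates of the Chevalley–Eilenberg differential of a 3-form. -/
def closedDefect : AlternatingMap ℝ V ℝ (Fin 3) →ₗ[ℝ] (Fin 8 → ℝ) where
  toFun φ :=
    let a : Fin 7 → Fin 7 → Fin 7 → ℝ := fun i j k => φ ![stdVec i, stdVec j, stdVec k]
    ![a 0 3 5 - a 1 3 4, a 0 4 5 - a 2 3 4, a 1 4 5 - a 2 3 5, a 1 4 6 - a 0 5 6 - a 2 3 6,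
      a 3 4 5, a 3 4 6, a 3 5 6, a 4 5 6]
  map_add' φ ψ := by
    ext k
    fin_cases k <;> simp <;> ring
  map_smul' c φ := by
    ext k
    fin_cases k <;> simp <;> ring

theorem w3_apply (i j k : Fin 7) (x y z : V) :
    w3 i j k ![x, y, z] = x i * y j * z k - x i * y k * z j - x j * y i * z k +
      x j * y k * z i + x k * y i * z j - x k * y j * z i := by
  have h : w3 i j k ![x, y, z] =
      Matrix.det !![x i, x j, x k; y i, y j, y k; z i, z j, z k] := by
    change Matrix.det (_ : Matrix (Fin 3) (Fin 3) ℝ) = _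
    congr 1
    ext a b
    fin_cases a <;> fin_cases b <;> rfl
  rw [h, Matrix.det_fin_three]
  simp

theorem closedDefect_surjective : Function.Surjective closedDefect := fun c => by
  refine ⟨c 0 • w3 0 3 5 + c 1 • w3 0 4 5 + c 2 • w3 1 4 5 + c 3 • w3 1 4 6 + c 4 • w3 3 4 5 +
    c 5 • w3 3 4 6 + c 6 • w3 3 5 6 + c 7 • w3 4 5 6, ?_⟩
  ext k
  fin_cases k <;> simp [closedDefect, w3_apply]

theorem finrank_ker_closedDefect : Module.finrank ℝ (LinearMap.ker closedDefect) = 27 := by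
  have h := finrank_ker_of_surjective _ closedDefect_surjective
  simp [finrank_alternatingMap, Nat.choose] at h
  omega

/-- The values of `φ` on triples `(e_u, e_i, e_j)` with `u ∈ {4, 5, 6}` that the closedness
condition involves, with the arguments sorted. -/
theorem map_stdVec_sorted (φ : AlternatingMap ℝ V ℝ (Fin 3)) :
    φ ![stdVec 5, stdVec 0, stdVec 3] = φ ![stdVec 0, stdVec 3, stdVec 5] ∧
    φ ![stdVec 4, stdVec 1, stdVec 3] = φ ![stdVec 1, stdVec 3, stdVec 4] ∧
    φ ![stdVec 5, stdVec 0, stdVec 4] = φ ![stdVec 0, stdVec 4, stdVec 5] ∧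
    φ ![stdVec 3, stdVec 2, stdVec 4] = -φ ![stdVec 2, stdVec 3, stdVec 4] ∧
    φ ![stdVec 3, stdVec 2, stdVec 5] = -φ ![stdVec 2, stdVec 3, stdVec 5] ∧
    φ ![stdVec 4, stdVec 1, stdVec 5] = -φ ![stdVec 1, stdVec 4, stdVec 5] ∧
    φ ![stdVec 5, stdVec 0, stdVec 6] = -φ ![stdVec 0, stdVec 5, stdVec 6] ∧
    φ ![stdVec 4, stdVec 1, stdVec 6] = -φ ![stdVec 1, stdVec 4, stdVec 6] ∧
    φ ![stdVec 3, stdVec 2, stdVec 6] = -φ ![stdVec 2, stdVec 3, stdVec 6] ∧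
    φ ![stdVec 4, stdVec 3, stdVec 5] = -φ ![stdVec 3, stdVec 4, stdVec 5] ∧
    φ ![stdVec 5, stdVec 3, stdVec 4] = φ ![stdVec 3, stdVec 4, stdVec 5] ∧
    φ ![stdVec 4, stdVec 3, stdVec 6] = -φ ![stdVec 3, stdVec 4, stdVec 6] ∧
    φ ![stdVec 5, stdVec 3, stdVec 6] = -φ ![stdVec 3, stdVec 5, stdVec 6] ∧
    φ ![stdVec 5, stdVec 4, stdVec 6] = -φ ![stdVec 4, stdVec 5, stdVec 6] := by
  refine ⟨?_,
    ?_,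
    ?_,
    ?_,
    ?_,
    ?_,
    ?_,
    ?_,
    ?_,
    ?_,
    ?_,
    ?_,
    ?_,
    ?_⟩
  · rw [map_swap_left φ (stdVec 0) (stdVec 5) (stdVec 3), map_swap_right φ (stdVec 0) (stdVec 3) (stdVec 5), neg_neg]
  · rw [map_swap_left φ (stdVec 1) (stdVec 4) (stdVec 3), map_swap_right φ (stdVec 1) (stdVec 3) (stdVec 4), neg_neg]
  · rw [map_swap_left φ (stdVec 0) (stdVec 5) (stdVec 4), map_swap_right φ (stdVec 0) (stdVec 4) (stdVec 5), neg_neg]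
  · rw [map_swap_left φ (stdVec 2) (stdVec 3) (stdVec 4)]
  · rw [map_swap_left φ (stdVec 2) (stdVec 3) (stdVec 5)]
  · rw [map_swap_left φ (stdVec 1) (stdVec 4) (stdVec 5)]
  · rw [map_swap_left φ (stdVec 0) (stdVec 5) (stdVec 6)]
  · rw [map_swap_left φ (stdVec 1) (stdVec 4) (stdVec 6)]
  · rw [map_swap_left φ (stdVec 2) (stdVec 3) (stdVec 6)]
  · rw [map_swap_left φ (stdVec 3) (stdVec 4) (stdVec 5)]
  · rw [map_swap_left φ (stdVec 3) (stdVec 5) (stdVec 4), map_swap_right φ (stdVec 3) (stdVec 4) (stdVec 5), neg_neg]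
  · rw [map_swap_left φ (stdVec 3) (stdVec 4) (stdVec 6)]
  · rw [map_swap_left φ (stdVec 3) (stdVec 5) (stdVec 6)]
  · rw [map_swap_left φ (stdVec 4) (stdVec 5) (stdVec 6)]

theorem closed3_iff (φ : AlternatingMap ℝ V ℝ (Fin 3)) : Closed3 φ ↔ closedDefect φ = 0 := by
  obtain ⟨s503, s413, s504, s324, s325, s415, s506, s416, s326, s435, s534, s436, s536, s546⟩ :=
    map_stdVec_sorted φ
  constructor
  · intro h
    have h0123 := h (stdVec 0) (stdVec 1) (stdVec 2) (stdVec 3)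
    have h0124 := h (stdVec 0) (stdVec 1) (stdVec 2) (stdVec 4)
    have h0125 := h (stdVec 0) (stdVec 1) (stdVec 2) (stdVec 5)
    have h0126 := h (stdVec 0) (stdVec 1) (stdVec 2) (stdVec 6)
    have h0145 := h (stdVec 0) (stdVec 1) (stdVec 4) (stdVec 5)
    have h0146 := h (stdVec 0) (stdVec 1) (stdVec 4) (stdVec 6)
    have h0156 := h (stdVec 0) (stdVec 1) (stdVec 5) (stdVec 6)
    have h0256 := h (stdVec 0) (stdVec 2) (stdVec 5) (stdVec 6)
    simp [d3, map_bk, map_left_self, map_outer_self, s503, s413, s504, s324, s325, s415, s506, s416, s326, s546] at h0123 h0124 h0125 h0126 h0145 h0146 h0156 h0256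
    ext k
    fin_cases k <;> simp [closedDefect] <;> linarith
  · intro h
    have hk := fun k => congrFun h k
    simp [Fin.forall_fin_succ, closedDefect] at hk
    obtain ⟨h035, h045, h145, h146, h345, h346, h356, h456⟩ := hk
    replace h035 := sub_eq_zero.mp h035
    replace h045 := sub_eq_zero.mp h045
    replace h145 := sub_eq_zero.mp h145
    replace h146 := eq_add_of_sub_eq (sub_eq_zero.mp h146)
    intro x y z w
    simp only [d3, map_bk, fun u => map_eq_sum_pairs φ u x y,
      fun u => map_eq_sum_pairs φ u x z, fun u => map_eq_sum_pairs φ u x w,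
      fun u => map_eq_sum_pairs φ u y z, fun u => map_eq_sum_pairs φ u y w,
      fun u => map_eq_sum_pairs φ u z w, map_left_self, map_outer_self]
    simp only [s503, s413, s504, s324, s325, s415, s506, s416, s326, s435, s534, s436, s536, s546,
      h035, h045, h145, h146, h345, h346, h356, h456]
    ring

theorem closed3_phi : Closed3 phi := by
  rw [closed3_iff]
  ext k
  fin_cases k <;> simp [closedDefect, phi, w3_apply]
  norm_num
/-! ### Stabilizers -/

theorem phi_add_smul_eta_apply (ε : ℝ) (x y z : V) :
    (phi + ε • eta) ![x, y, z] = w3 0 1 2 ![x, y, z] + w3 0 3 4 ![x, y, z] + w3 0 5 6 ![x, y, z] -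
      w3 1 3 5 ![x, y, z] + (2 + ε) * w3 1 4 6 ![x, y, z] + (1 + ε) * w3 2 3 6 ![x, y, z] +
      w3 2 4 5 ![x, y, z] := by
  simp [phi, eta]
  ring

/-- The derivation spanning the stabilizer of `phi`. -/
def stabGen : V →ₗ[ℝ] V :=
  Matrix.toLin' !![0, 0, 1, 0, 0, 0, 0;
    0, 0, 0, 0, 0, 0, 0;
    -1, 0, 0, 0, 0, 0, 0;
    0, 0, 0, 0, 0, -1, 0;
    0, 0, 0, 0, 0, 0, 0;
    0, 0, 0, 1, 0, 0, 0;
    0, 0, 0, 0, 0, 0, 0]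

theorem stabGen_apply (x : V) : stabGen x = ![x 2, 0, -x 0, -x 5, 0, x 3, 0] := by
  ext i
  fin_cases i <;> simp [stabGen, Matrix.mulVec, dotProduct, Fin.sum_univ_succ]

theorem isDeriv_stabGen : IsDeriv stabGen := fun x y => by
  ext i
  fin_cases i <;> simp [stabGen_apply, bk] <;> ring

set_option linter.unusedSimpArgs false in
set_option maxHeartbeats 1000000 in
theorem stab3_eq_smul_stabGen {ε : ℝ} (hε : |ε| < 1) {D : V →ₗ[ℝ] V} (hD : IsDeriv D)
    (hs : Stab3 (phi + ε • eta) D) :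
    D = D (stdVec 2) 0 • stabGen ∧ ε * D (stdVec 2) 0 = 0 := by
  have hk := fun k => congrFun ((isDeriv_iff D).mp hD) k
  simp [Fin.forall_fin_succ, derivDefect] at hk
  obtain ⟨h03, h04, h05, h06, h13, h14, h15, h16, h23, h24, h25, h26, h63, h64, h65,
    h33, h43, h53, h34, h44, h54, h35, h45, h55⟩ := hk
  rw [sub_eq_zero] at h33 h43 h34 h44 h54 h45 h55
  rw [add_eq_zero_iff_eq_neg] at h53 h35
  simp only [Stab3, phi_add_smul_eta_apply, w3_apply] at hs
  have e012 : D (stdVec 0) 0 + D (stdVec 1) 1 + D (stdVec 2) 2 = 0 := by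
    have h := hs (stdVec 0) (stdVec 1) (stdVec 2)
    simp [h03, h04, h05, h06, h13, h14, h15, h16, h23, h24, h25, h26, h63, h64, h65,
      h33, h43, h53, h34, h44, h54, h35, h45, h55] at h
    linarith
  have e013 : D (stdVec 0) 5 + D (stdVec 1) 4 = 0 := by
    have h := hs (stdVec 0) (stdVec 1) (stdVec 3)
    simp [h03, h04, h05, h06, h13, h14, h15, h16, h23, h24, h25, h26, h63, h64, h65,
      h33, h43, h53, h34, h44, h54, h35, h45, h55] at h
    linarith
  have e014 : (2 + ε) * D (stdVec 0) 6 + D (stdVec 1) 3 = 0 := by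
    have h := hs (stdVec 0) (stdVec 1) (stdVec 4)
    simp [h03, h04, h05, h06, h13, h14, h15, h16, h23, h24, h25, h26, h63, h64, h65,
      h33, h43, h53, h34, h44, h54, h35, h45, h55] at h
    linarith
  have e015 : D (stdVec 0) 3 - D (stdVec 1) 6 = 0 := by
    have h := hs (stdVec 0) (stdVec 1) (stdVec 5)
    simp [h03, h04, h05, h06, h13, h14, h15, h16, h23, h24, h25, h26, h63, h64, h65,
      h33, h43, h53, h34, h44, h54, h35, h45, h55] at h
    linarith
  have e016 : D (stdVec 1) 5 - (2 + ε) * D (stdVec 0) 4 = 0 := by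
    have h := hs (stdVec 0) (stdVec 1) (stdVec 6)
    simp [h03, h04, h05, h06, h13, h14, h15, h16, h23, h24, h25, h26, h63, h64, h65,
      h33, h43, h53, h34, h44, h54, h35, h45, h55] at h
    linarith
  have e023 : (1 + ε) * D (stdVec 0) 6 - D (stdVec 2) 4 = 0 := by
    have h := hs (stdVec 0) (stdVec 2) (stdVec 3)
    simp [h03, h04, h05, h06, h13, h14, h15, h16, h23, h24, h25, h26, h63, h64, h65,
      h33, h43, h53, h34, h44, h54, h35, h45, h55] at h
    linarith
  have e024 : D (stdVec 0) 5 + D (stdVec 2) 3 = 0 := by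
    have h := hs (stdVec 0) (stdVec 2) (stdVec 4)
    simp [h03, h04, h05, h06, h13, h14, h15, h16, h23, h24, h25, h26, h63, h64, h65,
      h33, h43, h53, h34, h44, h54, h35, h45, h55] at h
    linarith
  have e025 : D (stdVec 0) 4 + D (stdVec 2) 6 = 0 := by
    have h := hs (stdVec 0) (stdVec 2) (stdVec 5)
    simp [h03, h04, h05, h06, h13, h14, h15, h16, h23, h24, h25, h26, h63, h64, h65,
      h33, h43, h53, h34, h44, h54, h35, h45, h55] at h
    linarith
  have e026 : D (stdVec 2) 5 - (1 + ε) * D (stdVec 0) 3 = 0 := by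
    have h := hs (stdVec 0) (stdVec 2) (stdVec 6)
    simp [h03, h04, h05, h06, h13, h14, h15, h16, h23, h24, h25, h26, h63, h64, h65,
      h33, h43, h53, h34, h44, h54, h35, h45, h55] at h
    linarith
  have e034 : 3 * D (stdVec 0) 0 + D (stdVec 1) 1 + D (stdVec 2) 2 = 0 := by
    have h := hs (stdVec 0) (stdVec 3) (stdVec 4)
    simp [h03, h04, h05, h06, h13, h14, h15, h16, h23, h24, h25, h26, h63, h64, h65,
      h33, h43, h53, h34, h44, h54, h35, h45, h55] at h
    linarith
  have e035 : D (stdVec 1) 0 - D (stdVec 0) 1 = 0 := by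
    have h := hs (stdVec 0) (stdVec 3) (stdVec 5)
    simp [h03, h04, h05, h06, h13, h14, h15, h16, h23, h24, h25, h26, h63, h64, h65,
      h33, h43, h53, h34, h44, h54, h35, h45, h55] at h
    linarith
  have e036 : ε * D (stdVec 0) 2 + D (stdVec 6) 4 = 0 := by
    have h := hs (stdVec 0) (stdVec 3) (stdVec 6)
    simp [h03, h04, h05, h06, h13, h14, h15, h16, h23, h24, h25, h26, h63, h64, h65,
      h33, h43, h53, h34, h44, h54, h35, h45, h55] at h
    linarith
  have e045 : D (stdVec 0) 2 + D (stdVec 2) 0 = 0 := by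
    have h := hs (stdVec 0) (stdVec 4) (stdVec 5)
    simp [h03, h04, h05, h06, h13, h14, h15, h16, h23, h24, h25, h26, h63, h64, h65,
      h33, h43, h53, h34, h44, h54, h35, h45, h55] at h
    linarith
  have e046 : (3 + ε) * D (stdVec 0) 1 - D (stdVec 6) 3 = 0 := by
    have h := hs (stdVec 0) (stdVec 4) (stdVec 6)
    simp [h03, h04, h05, h06, h13, h14, h15, h16, h23, h24, h25, h26, h63, h64, h65,
      h33, h43, h53, h34, h44, h54, h35, h45, h55] at h
    linarith
  have e056 : D (stdVec 0) 0 + D (stdVec 1) 1 + D (stdVec 2) 2 + D (stdVec 6) 6 = 0 := by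
    have h := hs (stdVec 0) (stdVec 5) (stdVec 6)
    simp [h03, h04, h05, h06, h13, h14, h15, h16, h23, h24, h25, h26, h63, h64, h65,
      h33, h43, h53, h34, h44, h54, h35, h45, h55] at h
    linarith
  have e123 : (1 + ε) * D (stdVec 1) 6 + D (stdVec 2) 5 = 0 := by
    have h := hs (stdVec 1) (stdVec 2) (stdVec 3)
    simp [h03, h04, h05, h06, h13, h14, h15, h16, h23, h24, h25, h26, h63, h64, h65,
      h33, h43, h53, h34, h44, h54, h35, h45, h55] at h
    linarith
  have e124 : D (stdVec 1) 5 - (2 + ε) * D (stdVec 2) 6 = 0 := by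
    have h := hs (stdVec 1) (stdVec 2) (stdVec 4)
    simp [h03, h04, h05, h06, h13, h14, h15, h16, h23, h24, h25, h26, h63, h64, h65,
      h33, h43, h53, h34, h44, h54, h35, h45, h55] at h
    linarith
  have e125 : D (stdVec 1) 4 + D (stdVec 2) 3 = 0 := by
    have h := hs (stdVec 1) (stdVec 2) (stdVec 5)
    simp [h03, h04, h05, h06, h13, h14, h15, h16, h23, h24, h25, h26, h63, h64, h65,
      h33, h43, h53, h34, h44, h54, h35, h45, h55] at h
    linarith
  have e126 : (2 + ε) * D (stdVec 2) 4 - (1 + ε) * D (stdVec 1) 3 = 0 := by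
    have h := hs (stdVec 1) (stdVec 2) (stdVec 6)
    simp [h03, h04, h05, h06, h13, h14, h15, h16, h23, h24, h25, h26, h63, h64, h65,
      h33, h43, h53, h34, h44, h54, h35, h45, h55] at h
    linarith
  have e135 : D (stdVec 0) 0 + 3 * D (stdVec 1) 1 + D (stdVec 2) 2 = 0 := by
    have h := hs (stdVec 1) (stdVec 3) (stdVec 5)
    simp [h03, h04, h05, h06, h13, h14, h15, h16, h23, h24, h25, h26, h63, h64, h65,
      h33, h43, h53, h34, h44, h54, h35, h45, h55] at h
    linarith
  have e136 : (3 + 2 * ε) * D (stdVec 1) 2 - D (stdVec 6) 5 = 0 := by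
    have h := hs (stdVec 1) (stdVec 3) (stdVec 6)
    simp [h03, h04, h05, h06, h13, h14, h15, h16, h23, h24, h25, h26, h63, h64, h65,
      h33, h43, h53, h34, h44, h54, h35, h45, h55] at h
    linarith
  have e145 : D (stdVec 1) 2 - D (stdVec 2) 1 = 0 := by
    have h := hs (stdVec 1) (stdVec 4) (stdVec 5)
    simp [h03, h04, h05, h06, h13, h14, h15, h16, h23, h24, h25, h26, h63, h64, h65,
      h33, h43, h53, h34, h44, h54, h35, h45, h55] at h
    linarith
  have e156 : (3 + ε) * D (stdVec 1) 0 + D (stdVec 6) 3 = 0 := by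
    have h := hs (stdVec 1) (stdVec 5) (stdVec 6)
    simp [h03, h04, h05, h06, h13, h14, h15, h16, h23, h24, h25, h26, h63, h64, h65,
      h33, h43, h53, h34, h44, h54, h35, h45, h55] at h
    linarith
  have e246 : (3 + 2 * ε) * D (stdVec 2) 1 + D (stdVec 6) 5 = 0 := by
    have h := hs (stdVec 2) (stdVec 4) (stdVec 6)
    simp [h03, h04, h05, h06, h13, h14, h15, h16, h23, h24, h25, h26, h63, h64, h65,
      h33, h43, h53, h34, h44, h54, h35, h45, h55] at h
    linarith
  have e256 : ε * D (stdVec 2) 0 + D (stdVec 6) 4 = 0 := by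
    have h := hs (stdVec 2) (stdVec 5) (stdVec 6)
    simp [h03, h04, h05, h06, h13, h14, h15, h16, h23, h24, h25, h26, h63, h64, h65,
      h33, h43, h53, h34, h44, h54, h35, h45, h55] at h
    linarith
  obtain ⟨hε₁, hε₂⟩ := abs_lt.mp hε
  have p1 : 0 < 1 + ε := by linarith
  have p2 : 0 < 2 + ε := by linarith
  have p3 : 0 < 3 + ε := by linarith
  have p4 : 0 < 3 + 2 * ε := by linarith
  have k10 : D (stdVec 0) 1 = 0 := by
    have h : (2 * (3 + ε)) * D (stdVec 0) 1 = 0 := by linear_combination e046 + e156 - (3 + ε) * e035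
    exact (mul_eq_zero.mp h).resolve_left (mul_ne_zero two_ne_zero p3.ne')
  have k21 : D (stdVec 1) 2 = 0 := by
    have h : (2 * (3 + 2 * ε)) * D (stdVec 1) 2 = 0 := by linear_combination e136 + e246 + (3 + 2 * ε) * e145
    exact (mul_eq_zero.mp h).resolve_left (mul_ne_zero two_ne_zero p4.ne')
  have k60 : D (stdVec 0) 6 = 0 := by
    have h : (2 * ((1 + ε) * (2 + ε))) * D (stdVec 0) 6 = 0 := by linear_combination (1 + ε) * e014 + (2 + ε) * e023 + e126
    exact (mul_eq_zero.mp h).resolve_left (mul_ne_zero two_ne_zero (mul_pos p1 p2).ne')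
  have k30 : D (stdVec 0) 3 = 0 := by
    have h : (2 * (1 + ε)) * D (stdVec 0) 3 = 0 := by linear_combination e123 - e026 + (1 + ε) * e015
    exact (mul_eq_zero.mp h).resolve_left (mul_ne_zero two_ne_zero p1.ne')
  have k40 : D (stdVec 0) 4 = 0 := by
    have h : (2 * (2 + ε)) * D (stdVec 0) 4 = 0 := by linear_combination e124 - e016 + (2 + ε) * e025
    exact (mul_eq_zero.mp h).resolve_left (mul_ne_zero two_ne_zero p2.ne')
  have k02 : ε * D (stdVec 2) 0 = 0 := by
    linear_combination (e256 - e036 + ε * e045) / 2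
  have k00 : D (stdVec 0) 0 = 0 := by linear_combination (e034 - e012) / 2
  have k11 : D (stdVec 1) 1 = 0 := by linear_combination (e135 - e012) / 2
  have k22 : D (stdVec 2) 2 = 0 := by linear_combination e012 - (e034 - e012) / 2 - (e135 - e012) / 2
  have k66 : D (stdVec 6) 6 = 0 := by linear_combination e056 - e012
  have k01 : D (stdVec 1) 0 = 0 := by linear_combination e035 + k10
  have k12 : D (stdVec 2) 1 = 0 := by linear_combination k21 - e145
  have k36 : D (stdVec 6) 3 = 0 := by linear_combination (3 + ε) * k10 - e046
  have k56 : D (stdVec 6) 5 = 0 := by linear_combination (3 + 2 * ε) * k21 - e136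
  have k46 : D (stdVec 6) 4 = 0 := by linear_combination e256 - k02
  have k31 : D (stdVec 1) 3 = 0 := by linear_combination e014 - (2 + ε) * k60
  have k42 : D (stdVec 2) 4 = 0 := by linear_combination (1 + ε) * k60 - e023
  have k61 : D (stdVec 1) 6 = 0 := by linear_combination k30 - e015
  have k52 : D (stdVec 2) 5 = 0 := by linear_combination e026 + (1 + ε) * k30
  have k51 : D (stdVec 1) 5 = 0 := by linear_combination e016 + (2 + ε) * k40
  have k62 : D (stdVec 2) 6 = 0 := by linear_combination e025 - k40
  have k50 : D (stdVec 0) 5 = 0 := by linear_combination (e013 + e024 - e125) / 2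
  have k41 : D (stdVec 1) 4 = 0 := by linear_combination (e013 + e125 - e024) / 2
  have k32 : D (stdVec 2) 3 = 0 := by linear_combination (e024 + e125 - e013) / 2
  refine ⟨linearMap_ext_stdVec fun j i => ?_, k02⟩
  fin_cases j <;> fin_cases i <;> simp [stabGen_apply] <;> linarith

theorem stabGen_ne_zero : stabGen ≠ 0 := fun h => by
  simpa [stabGen_apply] using congrFun (LinearMap.congr_fun h (stdVec 2)) 0

theorem mem_span_stabGen_iff (D : V →ₗ[ℝ] V) :
    D ∈ Submodule.span ℝ {stabGen} ↔ IsDeriv D ∧ Stab3 phi D := by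
  rw [Submodule.mem_span_singleton]
  constructor
  · rintro ⟨c, rfl⟩
    constructor
    · have h := (isDeriv_iff _).mp isDeriv_stabGen
      rw [isDeriv_iff, map_smul, h, smul_zero]
    · intro x y z
      simp [stabGen_apply, phi, w3_apply]
      ring
  · rintro ⟨hD, hs⟩
    exact ⟨_, (stab3_eq_smul_stabGen (ε := 0) (by simp) hD (by simpa using hs)).1.symm⟩

theorem statement_1 :
    (∃ Z : Submodule ℝ (AlternatingMap ℝ V ℝ (Fin 3)),
      (∀ φ, φ ∈ Z ↔ Closed3 φ) ∧ Module.finrank ℝ Z = 27) ∧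
    (∃ W : Submodule ℝ (V →ₗ[ℝ] V),
      (∀ D, D ∈ W ↔ IsDeriv D) ∧ Module.finrank ℝ W = 25) ∧
    Closed3 phi ∧
    (∃ S : Submodule ℝ (V →ₗ[ℝ] V),
      (∀ D, D ∈ S ↔ IsDeriv D ∧ Stab3 phi D) ∧ Module.finrank ℝ S = 1) ∧
    (∃ δ : ℝ, 0 < δ ∧ ∀ ε : ℝ, 0 < |ε| → |ε| < δ →
      ∀ D : V →ₗ[ℝ] V, IsDeriv D → Stab3 (phi + ε • eta) D → D = 0) := by
  refine ⟨⟨LinearMap.ker closedDefect, fun φ => ?_, finrank_ker_closedDefect⟩,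
    ⟨LinearMap.ker derivDefect, fun D => ?_, finrank_ker_derivDefect⟩, closed3_phi,
    ⟨Submodule.span ℝ {stabGen}, mem_span_stabGen_iff, finrank_span_singleton stabGen_ne_zero⟩,
    1, one_pos, fun ε hε₀ hε₁ D hD hs => ?_⟩
  · rw [closed3_iff, LinearMap.mem_ker]
  · rw [isDeriv_iff, LinearMap.mem_ker]
  · obtain ⟨h, h₀⟩ := stab3_eq_smul_stabGen hε₁ hD hs
    rw [h, (mul_eq_zero.mp h₀).resolve_left (abs_pos.mp hε₀), zero_smul]
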